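/- Let A₂, A₃, A₄ be pairwise transverse affine parabolic spaces in 𝔰𝔩ₙ(ℝ). Then the affine triple ratio δ(A₂,A₃,A₄) is independent of the choice of points X₂ ∈ A₂, X₃ ∈ A₃, X₄ ∈ A₄ used to define it, satisfies δ(A₂,A₃,A₄) = δ(A₃,A₄,A₂) = −δ(A₃,A₂,A₄), is invariant under the affine action: δ((g,Y)·A₂, (g,Y)·A₃, (g,Y)·A₄) = δ(A₂,A₃,A₄) for all (g,Y) ∈ SLₙ(ℝ) ⋉ 𝔰𝔩ₙ(ℝ), and satisfies ω₀ δ(A₂,A₃,A₄) = δ(A₂,A₃,A₄). -/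

import Mathlib

open Matrix

noncomputable section

abbrev Mn (n : ℕ) := Matrix (Fin n) (Fin n) ℝ

/-- Conjugation `Z ↦ g Z g⁻¹` as a linear map on matrices. -/
def AdM {n : ℕ} (g : Mn n) : Mn n →ₗ[ℝ] Mn n where
  toFun Z := g * Z * g⁻¹
  map_add' X Y := by simp [Matrix.add_mul, Matrix.mul_add]
  map_smul' c X := by simp [Matrix.smul_mul, Matrix.mul_smul]

/-- Projection onto the diagonal part. -/
def pi0 {n : ℕ} : Mn n →ₗ[ℝ] Mn n where
  toFun Z := Matrix.diagonal (fun i => Z i i)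
  map_add' X Y := by
    ext i j
    by_cases h : i = j <;> simp [Matrix.diagonal_apply, h]
  map_smul' c X := by
    ext i j
    by_cases h : i = j <;> simp [Matrix.diagonal_apply, h]

/-- The involution reversing the diagonal entries (on diagonal matrices). -/
def omega0 {n : ℕ} : Mn n →ₗ[ℝ] Mn n where
  toFun Z := Matrix.diagonal (fun i => Z i.rev i.rev)
  map_add' X Y := by
    ext i j
    by_cases h : i = j <;> simp [Matrix.diagonal_apply, h]
  map_smul' c X := by
    ext i j
    by_cases h : i = j <;> simp [Matrix.diagonal_apply, h]

/-- Traceless matrices: 𝔰𝔩ₙ(ℝ). -/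
def slSub (n : ℕ) : Submodule ℝ (Mn n) := LinearMap.ker (Matrix.traceLinearMap (Fin n) ℝ ℝ)

/-- Matrices vanishing below the diagonal (upper triangular). -/
def upTri (n : ℕ) : Submodule ℝ (Mn n) where
  carrier := {Z | ∀ i j : Fin n, j < i → Z i j = 0}
  add_mem' := by intro a b ha hb i j h; simp [Matrix.add_apply, ha i j h, hb i j h]
  zero_mem' := by intro i j h; rfl
  smul_mem' := by intro c a ha i j h; simp [Matrix.smul_apply, ha i j h]

/-- Matrices vanishing above the diagonal (lower triangular). -/
def loTri (n : ℕ) : Submodule ℝ (Mn n) where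
  carrier := {Z | ∀ i j : Fin n, i < j → Z i j = 0}
  add_mem' := by intro a b ha hb i j h; simp [Matrix.add_apply, ha i j h, hb i j h]
  zero_mem' := by intro i j h; rfl
  smul_mem' := by intro c a ha i j h; simp [Matrix.smul_apply, ha i j h]

/-- Diagonal matrices. -/
def diagSub (n : ℕ) : Submodule ℝ (Mn n) where
  carrier := {Z | ∀ i j : Fin n, i ≠ j → Z i j = 0}
  add_mem' := by intro a b ha hb i j h; simp [Matrix.add_apply, ha i j h, hb i j h]
  zero_mem' := by intro i j h; rfl
  smul_mem' := by intro c a ha i j h; simp [Matrix.smul_apply, ha i j h]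

/-- Strictly upper triangular matrices: 𝔫⁺. -/
def nplus (n : ℕ) : Submodule ℝ (Mn n) where
  carrier := {Z | ∀ i j : Fin n, j ≤ i → Z i j = 0}
  add_mem' := by intro a b ha hb i j h; simp [Matrix.add_apply, ha i j h, hb i j h]
  zero_mem' := by intro i j h; rfl
  smul_mem' := by intro c a ha i j h; simp [Matrix.smul_apply, ha i j h]

/-- Strictly lower triangular matrices: 𝔫⁻. -/
def nminus (n : ℕ) : Submodule ℝ (Mn n) where
  carrier := {Z | ∀ i j : Fin n, i ≤ j → Z i j = 0}
  add_mem' := by intro a b ha hb i j h; simp [Matrix.add_apply, ha i j h, hb i j h]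
  zero_mem' := by intro i j h; rfl
  smul_mem' := by intro c a ha i j h; simp [Matrix.smul_apply, ha i j h]

/-- 𝔟⁺ : traceless upper triangular matrices. -/
def bplus (n : ℕ) : Submodule ℝ (Mn n) := slSub n ⊓ upTri n

/-- 𝔟⁻ : traceless lower triangular matrices. -/
def bminus (n : ℕ) : Submodule ℝ (Mn n) := slSub n ⊓ loTri n

/-- 𝔞 : traceless diagonal matrices. -/
def aSub (n : ℕ) : Submodule ℝ (Mn n) := slSub n ⊓ diagSub n

/-- A parabolic subspace of 𝔰𝔩ₙ(ℝ): a subspace of the form Ad(g)𝔟⁺ with g ∈ SLₙ(ℝ). -/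
def IsParabolic {n : ℕ} (V : Submodule ℝ (Mn n)) : Prop :=
  ∃ g : Mn n, g.det = 1 ∧ V = (bplus n).map (AdM g)

/-- Two subspaces are transverse if together they span 𝔰𝔩ₙ(ℝ). -/
def Transv {n : ℕ} (V W : Submodule ℝ (Mn n)) : Prop := V ⊔ W = slSub n

/-- A standardizer of an ordered transverse pair of parabolic subspaces. -/
def IsStd {n : ℕ} (h : Mn n) (V₁ V₂ : Submodule ℝ (Mn n)) : Prop :=
  h.det = 1 ∧ (bplus n).map (AdM h) = V₁ ∧ (bminus n).map (AdM h) = V₂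

/-- ν*_{i,j} computed with the standardizer h. -/
def nustar {n : ℕ} (h : Mn n) : Mn n →ₗ[ℝ] Mn n := pi0 ∘ₗ AdM h⁻¹

/-- ν_{i,j} computed with the standardizer h. -/
def nuMap {n : ℕ} (h : Mn n) : Mn n →ₗ[ℝ] Mn n := AdM h ∘ₗ pi0

/-- π_{i,j} computed with the standardizer h. -/
def piStd {n : ℕ} (h : Mn n) : Mn n →ₗ[ℝ] Mn n := AdM h ∘ₗ pi0 ∘ₗ AdM h⁻¹

/-- The commutator subspace [V,V]. -/
def commSub {n : ℕ} (V : Submodule ℝ (Mn n)) : Submodule ℝ (Mn n) :=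
  Submodule.span ℝ {z | ∃ x ∈ V, ∃ y ∈ V, z = x * y - y * x}

/-- An affine parabolic space with direction V: an affine subspace X + V of 𝔰𝔩ₙ(ℝ)
whose direction V is a parabolic subspace. -/
def IsAffPara {n : ℕ} (A : Set (Mn n)) (V : Submodule ℝ (Mn n)) : Prop :=
  IsParabolic V ∧ ∃ X : Mn n, X ∈ slSub n ∧ A = {Z | Z - X ∈ V}

/-- `IsCross b A₁ A₂ A₃ A₄ V₁ V₂ V₃ V₄` : b is a value of the affine cross ratio
β(A₁,A₂,A₃,A₄), computed with some choice of standardizers and intersection points. -/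
def IsCross {n : ℕ} (b : Mn n) (A₁ A₂ A₃ A₄ : Set (Mn n))
    (V₁ V₂ V₃ V₄ : Submodule ℝ (Mn n)) : Prop :=
  ∃ h₁₄ h₂₃ : Mn n, ∃ X₁₃ X₂₄ : Mn n,
    IsStd h₁₄ V₁ V₄ ∧ IsStd h₂₃ V₂ V₃ ∧ X₁₃ ∈ A₁ ∩ A₃ ∧ X₂₄ ∈ A₂ ∩ A₄ ∧
    b = nustar h₁₄ (X₁₃ - X₂₄) - nustar h₂₃ (X₁₃ - X₂₄)

/-- `IsTriple d A₂ A₃ A₄ V₂ V₃ V₄` : d is a value of the affine triple ratio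
δ(A₂,A₃,A₄), computed with some choice of standardizers and points. -/
def IsTriple {n : ℕ} (d : Mn n) (A₂ A₃ A₄ : Set (Mn n))
    (V₂ V₃ V₄ : Submodule ℝ (Mn n)) : Prop :=
  ∃ h₂₃ h₃₂ h₃₄ h₄₃ h₄₂ h₂₄ : Mn n, ∃ X₂ X₃ X₄ : Mn n,
    IsStd h₂₃ V₂ V₃ ∧ IsStd h₃₂ V₃ V₂ ∧ IsStd h₃₄ V₃ V₄ ∧ IsStd h₄₃ V₄ V₃ ∧
    IsStd h₄₂ V₄ V₂ ∧ IsStd h₂₄ V₂ V₄ ∧ X₂ ∈ A₂ ∧ X₃ ∈ A₃ ∧ X₄ ∈ A₄ ∧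
    d = (nustar h₂₃ (X₂ - X₃) + nustar h₃₂ (X₂ - X₃))
      + (nustar h₃₄ (X₃ - X₄) + nustar h₄₃ (X₃ - X₄))
      + (nustar h₄₂ (X₄ - X₂) + nustar h₂₄ (X₄ - X₂))

/-- The affine action of (g,Y) ∈ SLₙ(ℝ) ⋉ 𝔰𝔩ₙ(ℝ) on 𝔰𝔩ₙ(ℝ). -/
def affMap {n : ℕ} (g Y : Mn n) : Mn n → Mn n := fun Z => g * Z * g⁻¹ + Y

/-- The permutation matrix of the longest Weyl group element, reversing the standard basis. -/
def revMatrix (n : ℕ) : Mn n := Matrix.of fun i j => if i = j.rev then 1 else 0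

/-- An invertible matrix carrying the standard pair `(𝔟⁺, 𝔟⁻)` to `(V₁, V₂)`. -/
structure Standardizes {n : ℕ} (h : Mn n) (V₁ V₂ : Submodule ℝ (Mn n)) : Prop where
  isUnit_det : IsUnit h.det
  map_bplus : (bplus n).map (AdM h) = V₁
  map_bminus : (bminus n).map (AdM h) = V₂

section

variable {n : ℕ}

theorem AdM_apply (g Z : Mn n) : AdM g Z = g * Z * g⁻¹ := rfl

theorem AdM_mul (g h : Mn n) : AdM (g * h) = AdM g ∘ₗ AdM h := by
  ext1 Z
  simp [AdM_apply, Matrix.mul_inv_rev, Matrix.mul_assoc]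

theorem AdM_one : AdM (1 : Mn n) = LinearMap.id := by
  ext1 Z
  simp [AdM_apply]

theorem map_AdM_mul (g h : Mn n) (V : Submodule ℝ (Mn n)) :
    V.map (AdM (g * h)) = (V.map (AdM h)).map (AdM g) := by
  rw [AdM_mul, Submodule.map_comp]

theorem map_AdM_inv_map_AdM {g : Mn n} (hg : IsUnit g.det) (V : Submodule ℝ (Mn n)) :
    (V.map (AdM g)).map (AdM g⁻¹) = V := by
  rw [← map_AdM_mul, Matrix.nonsing_inv_mul _ hg, AdM_one, Submodule.map_id]

theorem AdM_inv_AdM {g : Mn n} (hg : IsUnit g.det) (Z : Mn n) : AdM g⁻¹ (AdM g Z) = Z := by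
  rw [← LinearMap.comp_apply, ← AdM_mul, Matrix.nonsing_inv_mul _ hg, AdM_one, LinearMap.id_apply]

theorem trace_AdM {g : Mn n} (hg : IsUnit g.det) (Z : Mn n) : (AdM g Z).trace = Z.trace := by
  rw [AdM_apply, Matrix.trace_mul_comm, ← Matrix.mul_assoc, Matrix.nonsing_inv_mul _ hg,
    Matrix.one_mul]

theorem mem_bplus {Z : Mn n} : Z ∈ bplus n ↔ Z.trace = 0 ∧ ∀ i j : Fin n, j < i → Z i j = 0 :=
  Iff.rfl

theorem mem_bminus {Z : Mn n} : Z ∈ bminus n ↔ Z.trace = 0 ∧ ∀ i j : Fin n, i < j → Z i j = 0 :=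
  Iff.rfl

theorem pi0_apply_apply (Z : Mn n) (i j : Fin n) : pi0 Z i j = if i = j then Z i i else 0 := rfl

theorem omega0_apply_apply (Z : Mn n) (i j : Fin n) :
    omega0 Z i j = if i = j then Z i.rev i.rev else 0 := rfl

theorem nustar_apply (h Z : Mn n) : nustar h Z = pi0 (AdM h⁻¹ Z) := rfl

theorem revMatrix_mul_self : revMatrix n * revMatrix n = 1 := by
  ext i j
  simp [revMatrix, Matrix.mul_apply, Matrix.one_apply]

theorem revMatrix_inv : (revMatrix n)⁻¹ = revMatrix n :=
  Matrix.inv_eq_right_inv revMatrix_mul_self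

theorem isUnit_det_revMatrix : IsUnit (revMatrix n).det :=
  Matrix.isUnit_det_of_left_inverse revMatrix_mul_self

theorem AdM_revMatrix_apply (Z : Mn n) (i j : Fin n) :
    AdM (revMatrix n) Z i j = Z i.rev j.rev := by
  have e (k : Fin n) : i = k.rev ↔ i.rev = k := by rw [← Fin.rev_inj, Fin.rev_rev]
  rw [AdM_apply, revMatrix_inv]
  simp [revMatrix, Matrix.mul_apply, e]

theorem AdM_revMatrix_AdM_revMatrix (Z : Mn n) :
    AdM (revMatrix n) (AdM (revMatrix n) Z) = Z := by
  ext i j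
  simp [AdM_revMatrix_apply]

theorem map_revMatrix_bplus : (bplus n).map (AdM (revMatrix n)) = bminus n := by
  apply le_antisymm
  · rintro _ ⟨Z, hZ, rfl⟩
    refine mem_bminus.2 ⟨(trace_AdM isUnit_det_revMatrix Z).trans hZ.1, fun i j hij => ?_⟩
    rw [AdM_revMatrix_apply]
    exact hZ.2 _ _ (Fin.rev_lt_rev.2 hij)
  · intro Z hZ
    refine ⟨AdM (revMatrix n) Z, mem_bplus.2
      ⟨(trace_AdM isUnit_det_revMatrix Z).trans hZ.1, fun i j hij => ?_⟩,
      AdM_revMatrix_AdM_revMatrix Z⟩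
    rw [AdM_revMatrix_apply]
    exact hZ.2 _ _ (Fin.rev_lt_rev.2 hij)

theorem map_revMatrix_bminus : (bminus n).map (AdM (revMatrix n)) = bplus n := by
  rw [← map_revMatrix_bplus, ← map_AdM_mul, revMatrix_mul_self, AdM_one, Submodule.map_id]

theorem AdM_mem_upTri {g : Mn n} (hg : IsUnit g.det)
    (H : (bplus n).map (AdM g) ≤ bplus n) {x : Mn n} (hx : x ∈ upTri n) :
    AdM g x ∈ upTri n := by
  intro i j hij
  have hn : (n : ℝ) ≠ 0 := Nat.cast_ne_zero.2 (Fin.pos i).ne'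
  set c : ℝ := x.trace / n
  have hy : x - c • (1 : Mn n) ∈ bplus n := by
    refine mem_bplus.2 ⟨?_, fun a b hab => ?_⟩
    · simp [Matrix.trace_sub, Matrix.trace_smul, c, hn]
    · simp [hx a b hab, Matrix.one_apply_ne hab.ne']
  have h1 : AdM g (1 : Mn n) = 1 := by
    rw [AdM_apply, Matrix.mul_one, Matrix.mul_nonsing_inv _ hg]
  have := (H (Submodule.mem_map_of_mem hy)).2 i j hij
  simpa [h1, Matrix.one_apply_ne hij.ne'] using this

/-- The normalizer of `𝔟⁺` consists of upper triangular matrices. -/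
theorem mem_upTri_of_map_bplus_le {g : Mn n} (hg : IsUnit g.det)
    (H : (bplus n).map (AdM g) ≤ bplus n) : g ∈ upTri n := by
  intro a j hja
  by_contra hne
  have hzero : ∀ b < a, ∀ k, j ≤ k → g⁻¹ k b = 0 := by
    intro b hb k hk
    have hx : Matrix.single j k (1 : ℝ) ∈ upTri n := by
      intro p q hpq
      refine Matrix.single_apply_of_ne _ _ _ _ _ ?_
      rintro ⟨rfl, rfl⟩
      exact absurd hpq (not_lt.2 hk)
    have := AdM_mem_upTri hg H hx a b hb
    simpa [AdM_apply, Matrix.mul_apply, Matrix.single_apply, hne, ite_and] using this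
  have hdet : (g⁻¹).det ≠ 0 := (Matrix.isUnit_nonsing_inv_det _ hg).ne_zero
  rw [Matrix.det_apply] at hdet
  obtain ⟨σ, -, hσ⟩ := Finset.exists_ne_zero_of_sum_ne_zero hdet
  have hprod : ∏ i, g⁻¹ (σ i) i ≠ 0 := fun h => hσ (by rw [h, smul_zero])
  have hmaps : ∀ b ∈ Finset.Iio a, σ b ∈ Finset.Iio j := by
    intro b hb
    rw [Finset.mem_Iio] at hb ⊢
    by_contra hk
    exact hprod (Finset.prod_eq_zero (Finset.mem_univ b) (hzero b hb _ (not_lt.1 hk)))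
  have hcard := Finset.card_le_card_of_injOn σ hmaps σ.injective.injOn
  rw [Fin.card_Iio, Fin.card_Iio] at hcard
  exact absurd hja (not_lt.2 hcard)

theorem mul_apply_self_of_upTri {x y : Mn n} (hx : x ∈ upTri n) (hy : y ∈ upTri n)
    (i : Fin n) : (x * y) i i = x i i * y i i := by
  rw [Matrix.mul_apply]
  refine Finset.sum_eq_single i (fun k _ hk => ?_) (by simp)
  rcases lt_or_gt_of_ne hk with h | h
  · rw [hx i k h, zero_mul]
  · rw [hy k i h, mul_zero]

theorem mul_mem_upTri {x y : Mn n} (hx : x ∈ upTri n) (hy : y ∈ upTri n) :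
    x * y ∈ upTri n := by
  intro i j hij
  rw [Matrix.mul_apply]
  refine Finset.sum_eq_zero fun k _ => ?_
  rcases lt_or_ge k i with h | h
  · rw [hx i k h, zero_mul]
  · rw [hy k j (hij.trans_le h), mul_zero]

theorem pi0_conj_of_upTri {s t x : Mn n} (hs : s ∈ upTri n) (ht : t ∈ upTri n) (hst : s * t = 1)
    (hx : x ∈ upTri n) : pi0 (s * x * t) = pi0 x := by
  ext i j
  have h1 : s i i * t i i = 1 := by
    rw [← mul_apply_self_of_upTri hs ht, hst, Matrix.one_apply_eq]
  rw [pi0_apply_apply, pi0_apply_apply, mul_apply_self_of_upTri (mul_mem_upTri hs hx) ht,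
    mul_apply_self_of_upTri hs hx, mul_right_comm, h1, one_mul]

theorem pi0_conj_of_diagonal {s t : Mn n} (hs : s.IsDiag) (ht : t.IsDiag) (hst : s * t = 1)
    (x : Mn n) : pi0 (s * x * t) = pi0 x := by
  rw [← hs.diagonal_diag, ← ht.diagonal_diag, Matrix.diagonal_mul_diagonal] at hst
  ext i j
  have h1 := congrFun (congrFun hst i) i
  rw [Matrix.diagonal_apply_eq, Matrix.one_apply_eq] at h1
  rw [← hs.diagonal_diag, ← ht.diagonal_diag, pi0_apply_apply, pi0_apply_apply,
    Matrix.mul_diagonal, Matrix.diagonal_mul, mul_right_comm, h1, one_mul]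

theorem inv_mul_mem_upTri {h h' : Mn n} (hh : IsUnit h.det) (hh' : IsUnit h'.det)
    (H : (bplus n).map (AdM h) = (bplus n).map (AdM h')) : h⁻¹ * h' ∈ upTri n := by
  refine mem_upTri_of_map_bplus_le ?_ ?_
  · rw [Matrix.det_mul]
    exact (Matrix.isUnit_nonsing_inv_det _ hh).mul hh'
  · rw [map_AdM_mul, ← H, map_AdM_inv_map_AdM hh]

theorem inv_mul_mul_inv_mul {h h' : Mn n} (hh : IsUnit h.det) (hh' : IsUnit h'.det) :
    (h⁻¹ * h') * (h'⁻¹ * h) = 1 := by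
  rw [Matrix.mul_assoc, Matrix.mul_nonsing_inv_cancel_left _ _ hh', Matrix.nonsing_inv_mul _ hh]

theorem AdM_inv_eq_conj {h h' : Mn n} (hh : IsUnit h.det) (hh' : IsUnit h'.det) (Z : Mn n) :
    AdM h⁻¹ Z = (h⁻¹ * h') * AdM h'⁻¹ Z * (h'⁻¹ * h) := by
  simp only [AdM_apply, Matrix.nonsing_inv_nonsing_inv _ hh, Matrix.nonsing_inv_nonsing_inv _ hh',
    Matrix.mul_assoc, Matrix.mul_nonsing_inv_cancel_left _ _ hh']

namespace Standardizes

variable {h h' : Mn n} {V₁ V₂ V₃ : Submodule ℝ (Mn n)}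

theorem mul_revMatrix (H : Standardizes h V₁ V₂) : Standardizes (h * revMatrix n) V₂ V₁ where
  isUnit_det := by
    rw [Matrix.det_mul]
    exact H.isUnit_det.mul isUnit_det_revMatrix
  map_bplus := by rw [map_AdM_mul, map_revMatrix_bplus, H.map_bminus]
  map_bminus := by rw [map_AdM_mul, map_revMatrix_bminus, H.map_bplus]

theorem inv_mul_mem_upTri (H : Standardizes h V₁ V₂) (H' : Standardizes h' V₁ V₃) :
    h⁻¹ * h' ∈ upTri n :=
  _root_.inv_mul_mem_upTri H.isUnit_det H'.isUnit_det (H.map_bplus.trans H'.map_bplus.symm)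

theorem isDiag_inv_mul (H : Standardizes h V₁ V₂) (H' : Standardizes h' V₁ V₂) :
    (h⁻¹ * h').IsDiag := by
  intro i j hij
  rcases lt_or_gt_of_ne hij with hlt | hlt
  · have e : (h * revMatrix n)⁻¹ * (h' * revMatrix n) = AdM (revMatrix n) (h⁻¹ * h') := by
      simp only [AdM_apply, revMatrix_inv, Matrix.mul_inv_rev, Matrix.mul_assoc]
    have := H.mul_revMatrix.inv_mul_mem_upTri H'.mul_revMatrix i.rev j.rev (Fin.rev_lt_rev.2 hlt)
    simpa only [e, AdM_revMatrix_apply, Fin.rev_rev] using this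
  · exact H.inv_mul_mem_upTri H' i j hlt

theorem nustar_eq (H : Standardizes h V₁ V₂) (H' : Standardizes h' V₁ V₂) :
    nustar h = nustar h' := by
  ext1 Z
  rw [nustar_apply, nustar_apply, AdM_inv_eq_conj H.isUnit_det H'.isUnit_det,
    pi0_conj_of_diagonal (H.isDiag_inv_mul H') (H'.isDiag_inv_mul H)
      (inv_mul_mul_inv_mul H.isUnit_det H'.isUnit_det)]

theorem nustar_apply_eq_of_mem (H : Standardizes h V₁ V₂) (H' : Standardizes h' V₁ V₃)
    {v : Mn n} (hv : v ∈ V₁) : nustar h v = nustar h' v := by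
  have hx : AdM h'⁻¹ v ∈ upTri n := by
    rw [← H'.map_bplus] at hv
    obtain ⟨x, hx, rfl⟩ := hv
    rw [AdM_inv_AdM H'.isUnit_det]
    exact hx.2
  rw [nustar_apply, nustar_apply, AdM_inv_eq_conj H.isUnit_det H'.isUnit_det,
    pi0_conj_of_upTri (H.inv_mul_mem_upTri H') (H'.inv_mul_mem_upTri H)
      (inv_mul_mul_inv_mul H.isUnit_det H'.isUnit_det) hx]

theorem nustar_swap (H : Standardizes h V₁ V₂) (H' : Standardizes h' V₂ V₁) (Z : Mn n) :
    nustar h' Z = omega0 (nustar h Z) := by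
  rw [H'.nustar_eq H.mul_revMatrix]
  ext i j
  rw [nustar_apply, nustar_apply, Matrix.mul_inv_rev, AdM_mul, revMatrix_inv, omega0_apply_apply,
    pi0_apply_apply, pi0_apply_apply, if_pos rfl, LinearMap.comp_apply, AdM_revMatrix_apply]

theorem omega0_nustar_add (H : Standardizes h V₁ V₂) (H' : Standardizes h' V₂ V₁) (Z : Mn n) :
    omega0 (nustar h Z + nustar h' Z) = nustar h Z + nustar h' Z := by
  rw [map_add, ← H.nustar_swap H', ← H'.nustar_swap H, add_comm]

theorem nustar_add_eq_of_mem {k k' : Mn n} (H : Standardizes h V₁ V₂)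
    (H' : Standardizes h' V₂ V₁) (K : Standardizes k V₁ V₃) (K' : Standardizes k' V₃ V₁)
    {v : Mn n} (hv : v ∈ V₁) :
    nustar h v + nustar h' v = nustar k v + nustar k' v := by
  rw [H.nustar_swap H', K.nustar_swap K', H.nustar_apply_eq_of_mem K hv]

end Standardizes

theorem IsStd.standardizes {h : Mn n} {V₁ V₂ : Submodule ℝ (Mn n)} (H : IsStd h V₁ V₂) :
    Standardizes h V₁ V₂ :=
  ⟨by rw [H.1]; exact isUnit_one, H.2.1, H.2.2⟩

theorem IsAffPara.sub_mem {A : Set (Mn n)} {V : Submodule ℝ (Mn n)} (H : IsAffPara A V)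
    {X Y : Mn n} (hX : X ∈ A) (hY : Y ∈ A) : X - Y ∈ V := by
  obtain ⟨-, P, -, rfl⟩ := H
  simpa using V.sub_mem hX hY

theorem IsStd.inv_mul {g h : Mn n} (hg : g.det = 1) {V₁ V₂ : Submodule ℝ (Mn n)}
    (H : IsStd h (V₁.map (AdM g)) (V₂.map (AdM g))) : IsStd (g⁻¹ * h) V₁ V₂ := by
  have hu : IsUnit g.det := by rw [hg]; exact isUnit_one
  refine ⟨?_, ?_, ?_⟩
  · rw [Matrix.det_mul, Matrix.det_nonsing_inv, hg, H.1, Ring.inverse_one, one_mul]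
  · rw [map_AdM_mul, H.2.1, map_AdM_inv_map_AdM hu]
  · rw [map_AdM_mul, H.2.2, map_AdM_inv_map_AdM hu]

theorem nustar_affMap_sub {g : Mn n} (hg : g.det = 1) (h Y X X' : Mn n) :
    nustar h (affMap g Y X - affMap g Y X') = nustar (g⁻¹ * h) (X - X') := by
  have hu : IsUnit g.det := by rw [hg]; exact isUnit_one
  have e : affMap g Y X - affMap g Y X' = AdM g (X - X') := by
    rw [map_sub, AdM_apply, AdM_apply, affMap, affMap, add_sub_add_right_eq_sub]
  rw [e, nustar_apply, nustar_apply, Matrix.mul_inv_rev, Matrix.nonsing_inv_nonsing_inv _ hu,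
    AdM_mul, LinearMap.comp_apply]

namespace IsTriple

variable {A₂ A₃ A₄ : Set (Mn n)} {V₂ V₃ V₄ : Submodule ℝ (Mn n)} {d d' : Mn n}

theorem rotate (H : IsTriple d A₃ A₄ A₂ V₃ V₄ V₂) : IsTriple d A₂ A₃ A₄ V₂ V₃ V₄ := by
  obtain ⟨h₃₄, h₄₃, h₄₂, h₂₄, h₂₃, h₃₂, X₃, X₄, X₂, s₃₄, s₄₃, s₄₂, s₂₄, s₂₃, s₃₂, m₃, m₄, m₂, rfl⟩ :=
    H
  exact ⟨h₂₃, h₃₂, h₃₄, h₄₃, h₄₂, h₂₄, X₂, X₃, X₄, s₂₃, s₃₂, s₃₄, s₄₃, s₄₂, s₂₄, m₂, m₃, m₄,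
    by abel⟩

theorem neg_swap (H : IsTriple d A₃ A₂ A₄ V₃ V₂ V₄) : IsTriple (-d) A₂ A₃ A₄ V₂ V₃ V₄ := by
  obtain ⟨h₃₂, h₂₃, h₂₄, h₄₂, h₄₃, h₃₄, X₃, X₂, X₄, s₃₂, s₂₃, s₂₄, s₄₂, s₄₃, s₃₄, m₃, m₂, m₄, rfl⟩ :=
    H
  refine ⟨h₂₃, h₃₂, h₃₄, h₄₃, h₄₂, h₂₄, X₂, X₃, X₄, s₂₃, s₃₂, s₃₄, s₄₃, s₄₂, s₂₄, m₂, m₃, m₄, ?_⟩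
  simp only [map_sub]
  abel

theorem of_affMap {g Y : Mn n} (hg : g.det = 1)
    (H : IsTriple d (affMap g Y '' A₂) (affMap g Y '' A₃) (affMap g Y '' A₄)
      (V₂.map (AdM g)) (V₃.map (AdM g)) (V₄.map (AdM g))) :
    IsTriple d A₂ A₃ A₄ V₂ V₃ V₄ := by
  obtain ⟨h₂₃, h₃₂, h₃₄, h₄₃, h₄₂, h₂₄, _, _, _, s₂₃, s₃₂, s₃₄, s₄₃, s₄₂, s₂₄,
    ⟨X₂, m₂, rfl⟩, ⟨X₃, m₃, rfl⟩, ⟨X₄, m₄, rfl⟩, rfl⟩ := H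
  refine ⟨_, _, _, _, _, _, X₂, X₃, X₄, s₂₃.inv_mul hg, s₃₂.inv_mul hg, s₃₄.inv_mul hg,
    s₄₃.inv_mul hg, s₄₂.inv_mul hg, s₂₄.inv_mul hg, m₂, m₃, m₄, ?_⟩
  simp only [nustar_affMap_sub hg]

theorem eq (h₂ : IsAffPara A₂ V₂) (h₃ : IsAffPara A₃ V₃) (h₄ : IsAffPara A₄ V₄)
    (H : IsTriple d A₂ A₃ A₄ V₂ V₃ V₄) (H' : IsTriple d' A₂ A₃ A₄ V₂ V₃ V₄) : d = d' := by
  obtain ⟨h₂₃, h₃₂, h₃₄, h₄₃, h₄₂, h₂₄, X₂, X₃, X₄, s₂₃, s₃₂, s₃₄, s₄₃, s₄₂, s₂₄, m₂, m₃, m₄, rfl⟩ :=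
    H
  obtain ⟨k₂₃, k₃₂, k₃₄, k₄₃, k₄₂, k₂₄, Y₂, Y₃, Y₄, r₂₃, r₃₂, r₃₄, r₄₃, r₄₂, r₂₄, l₂, l₃, l₄, rfl⟩ :=
    H'
  rw [← s₂₃.standardizes.nustar_eq r₂₃.standardizes, ← s₃₂.standardizes.nustar_eq r₃₂.standardizes,
    ← s₃₄.standardizes.nustar_eq r₃₄.standardizes, ← s₄₃.standardizes.nustar_eq r₄₃.standardizes,
    ← s₄₂.standardizes.nustar_eq r₄₂.standardizes, ← s₂₄.standardizes.nustar_eq r₂₄.standardizes]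
  have e₂ := s₂₃.standardizes.nustar_add_eq_of_mem s₃₂.standardizes s₂₄.standardizes
    s₄₂.standardizes (h₂.sub_mem m₂ l₂)
  have e₃ := s₃₄.standardizes.nustar_add_eq_of_mem s₄₃.standardizes s₃₂.standardizes
    s₂₃.standardizes (h₃.sub_mem m₃ l₃)
  have e₄ := s₄₂.standardizes.nustar_add_eq_of_mem s₂₄.standardizes s₄₃.standardizes
    s₃₄.standardizes (h₄.sub_mem m₄ l₄)
  simp only [map_sub] at e₂ e₃ e₄ ⊢
  linear_combination (norm := module) e₂ + e₃ + e₄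

theorem omega0_eq (H : IsTriple d A₂ A₃ A₄ V₂ V₃ V₄) : omega0 d = d := by
  obtain ⟨h₂₃, h₃₂, h₃₄, h₄₃, h₄₂, h₂₄, X₂, X₃, X₄, s₂₃, s₃₂, s₃₄, s₄₃, s₄₂, s₂₄, -, -, -, rfl⟩ := H
  rw [map_add omega0, map_add omega0, s₂₃.standardizes.omega0_nustar_add s₃₂.standardizes,
    s₃₄.standardizes.omega0_nustar_add s₄₃.standardizes,
    s₄₂.standardizes.omega0_nustar_add s₂₄.standardizes]

end IsTriple

end

/-- Let A₂, A₃, A₄ be pairwise transverse affine parabolic spaces in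
𝔰𝔩ₙ(ℝ). Then the affine triple ratio δ(A₂,A₃,A₄) is well defined (independent of the
choices made in its definition), satisfies δ(A₂,A₃,A₄) = δ(A₃,A₄,A₂) = −δ(A₃,A₂,A₄), is
invariant under the affine action of SLₙ(ℝ) ⋉ 𝔰𝔩ₙ(ℝ), and satisfies ω₀ δ = δ. -/
theorem affine_triple_ratio_properties (n : ℕ) (hn : 2 ≤ n)
    (A₂ A₃ A₄ : Set (Mn n)) (V₂ V₃ V₄ : Submodule ℝ (Mn n))
    (h₂ : IsAffPara A₂ V₂) (h₃ : IsAffPara A₃ V₃) (h₄ : IsAffPara A₄ V₄)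
    (t₂₃ : Transv V₂ V₃) (t₂₄ : Transv V₂ V₄) (t₃₄ : Transv V₃ V₄) :
    (∀ d d' : Mn n, IsTriple d A₂ A₃ A₄ V₂ V₃ V₄ → IsTriple d' A₂ A₃ A₄ V₂ V₃ V₄ →
      d = d') ∧
    (∀ d d' : Mn n, IsTriple d A₂ A₃ A₄ V₂ V₃ V₄ → IsTriple d' A₃ A₄ A₂ V₃ V₄ V₂ →
      d = d') ∧
    (∀ d d' : Mn n, IsTriple d A₂ A₃ A₄ V₂ V₃ V₄ → IsTriple d' A₃ A₂ A₄ V₃ V₂ V₄ →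
      d = -d') ∧
    (∀ g Y : Mn n, g.det = 1 → Y.trace = 0 →
      ∀ d d' : Mn n,
        IsTriple d (affMap g Y '' A₂) (affMap g Y '' A₃) (affMap g Y '' A₄)
          (V₂.map (AdM g)) (V₃.map (AdM g)) (V₄.map (AdM g)) →
        IsTriple d' A₂ A₃ A₄ V₂ V₃ V₄ → d = d') ∧
    (∀ d : Mn n, IsTriple d A₂ A₃ A₄ V₂ V₃ V₄ → omega0 d = d) :=
  ⟨fun _ _ H H' => H.eq h₂ h₃ h₄ H',
    fun _ _ H H' => H.eq h₂ h₃ h₄ H'.rotate,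
    fun _ _ H H' => H.eq h₂ h₃ h₄ H'.neg_swap,
    fun _ _ hg _ _ _ H H' => (H.of_affMap hg).eq h₂ h₃ h₄ H',
    fun _ H => H.omega0_eq⟩

end
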